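/- Let k ≥ 0, D ≥ 0, and let G be a connected simple graph with the path metric in which every edge has length 1, such that every geodesic triangle in G is k-centered. Let g₁, g₂, g₃ be geodesics in G, where gᵢ runs from a vertex aᵢ to a vertex bᵢ, and suppose d(b₁, a₂) ≤ D, d(b₂, a₃) ≤ D, and d(b₃, a₁) ≤ D. Then there exists a vertex z of G whose distance to (the vertex set of) each of g₁, g₂, g₃ is at most 5k + D. -/

import Mathlib

namespace SimpleGraph

variable {V : Type*} {G : SimpleGraph V}

/-- Every geodesic triangle of `G` has a vertex at distance at most `K` from each of its sides. -/
def HasCenteredTriangles (G : SimpleGraph V) (K : ℕ) : Prop :=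
  ∀ (a b c : V) (w₁ : G.Walk a b) (w₂ : G.Walk b c) (w₃ : G.Walk c a),
    w₁.length = G.dist a b → w₂.length = G.dist b c → w₃.length = G.dist c a →
    ∃ z : V, (∃ p ∈ w₁.support, G.dist z p ≤ K) ∧ (∃ p ∈ w₂.support, G.dist z p ≤ K) ∧
      (∃ p ∈ w₃.support, G.dist z p ≤ K)

theorem Walk.dist_getVert_of_length_eq_dist {u v : V} {w : G.Walk u v}
    (hw : w.length = G.dist u v) {i j : ℕ} (hij : i ≤ j) (hj : j ≤ w.length) :
    G.dist (w.getVert i) (w.getVert j) = j - i := by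
  have h := length_eq_dist_of_subwalk hw
    (((w.drop i).isSubwalk_take (j - i)).trans (w.isSubwalk_drop i))
  rw [Walk.take_length, Walk.drop_length, Walk.drop_getVert, Nat.add_sub_cancel' hij] at h
  omega

theorem Connected.dist_add_dist_of_mem_support (hG : G.Connected) {u v x : V} {w : G.Walk u v}
    (hw : w.length = G.dist u v) (hx : x ∈ w.support) :
    G.dist u x + G.dist x v = G.dist u v := by
  classical
  have h := congrArg Walk.length (w.take_spec hx)
  rw [Walk.length_append] at h
  have := dist_le (w.takeUntil x hx)
  have := dist_le (w.dropUntil x hx)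
  have := hG.dist_triangle (u := u) (v := x) (w := v)
  omega

/-- Comparison points on the two sides issuing from `x` of a geodesic triangle. -/
theorem HasCenteredTriangles.exists_dist_le {K : ℕ} (h : G.HasCenteredTriangles K)
    (hG : G.Connected) {x y z : V} {w₁ : G.Walk x y} {w₂ : G.Walk x z}
    (h₁ : w₁.length = G.dist x y) (h₂ : w₂.length = G.dist x z) :
    ∃ q ∈ w₁.support, ∃ r ∈ w₂.support, ∃ s, G.dist q r ≤ 2 * K ∧ G.dist q s ≤ 2 * K ∧
      G.dist y s + G.dist s z = G.dist y z := by
  obtain ⟨w, hw⟩ := hG.exists_walk_length_eq_dist y z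
  obtain ⟨c, ⟨q, hq, hcq⟩, ⟨s, hs, hcs⟩, ⟨r, hr, hcr⟩⟩ :=
    h x y z w₁ w w₂.reverse h₁ hw (by rw [Walk.length_reverse, h₂, dist_comm])
  have hqr := hG.dist_triangle (u := q) (v := c) (w := r)
  have hqs := hG.dist_triangle (u := q) (v := c) (w := s)
  rw [G.dist_comm (u := q) (v := c)] at hqr hqs
  exact ⟨q, hq, r, by simpa using hr, s, by omega, by omega,
    hG.dist_add_dist_of_mem_support hw hs⟩

/-- Two geodesics issuing from a common vertex fellow travel, up to the distance of their ends. -/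
theorem HasCenteredTriangles.exists_mem_support_dist_le {K : ℕ} (h : G.HasCenteredTriangles K)
    (hG : G.Connected) {x y z : V} {w₁ : G.Walk x y} {w₂ : G.Walk x z}
    (h₁ : w₁.length = G.dist x y) (h₂ : w₂.length = G.dist x z) {p : V} (hp : p ∈ w₁.support) :
    ∃ r ∈ w₂.support, G.dist p r ≤ 4 * K + G.dist y z := by
  classical
  obtain ⟨n, rfl, hn⟩ := Walk.mem_support_iff_exists_getVert.mp hp
  obtain ⟨q, hq, r, hr, s, hqr, hqs, hs⟩ := h.exists_dist_le hG h₁ h₂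
  obtain ⟨j, rfl, hj⟩ := Walk.mem_support_iff_exists_getVert.mp hq
  rcases le_total j n with hjn | hnj
  · refine ⟨r, hr, ?_⟩
    have hqp := Walk.dist_getVert_of_length_eq_dist h₁ hjn hn
    have hqy := Walk.dist_getVert_of_length_eq_dist h₁ hj le_rfl
    rw [Walk.getVert_length] at hqy
    have hqsy := hG.dist_triangle (u := w₁.getVert j) (v := s) (w := y)
    have hpqr := hG.dist_triangle (u := w₁.getVert n) (v := w₁.getVert j) (w := r)
    rw [G.dist_comm (u := s)] at hqsy
    rw [G.dist_comm (u := w₁.getVert n) (v := w₁.getVert j)] at hpqr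
    omega
  · have hex : ∃ j, n ≤ j ∧ j ≤ w₁.length ∧ ∃ r ∈ w₂.support, G.dist (w₁.getVert j) r ≤ 2 * K :=
      ⟨j, hnj, hj, r, hr, hqr⟩
    clear! j r s
    obtain ⟨j, ⟨hnj, hj, r, hr, hjr⟩, hmin⟩ := Nat.findX hex
    have hpj := Walk.dist_getVert_of_length_eq_dist h₁ hnj hj
    have hpjr := hG.dist_triangle (u := w₁.getVert n) (v := w₁.getVert j) (w := r)
    rcases hnj.eq_or_lt with rfl | hlt
    · exact ⟨r, hr, by omega⟩
    obtain ⟨q, hq, t, ht, s, hqt, hqs, hs⟩ := h.exists_dist_le hG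
      (length_eq_dist_of_subwalk h₁ (w₁.isSubwalk_take (j - 1)))
      (length_eq_dist_of_subwalk h₂ (w₂.isSubwalk_takeUntil hr))
    obtain ⟨i, rfl, hi⟩ := Walk.mem_support_iff_exists_getVert.mp hq
    rw [Walk.take_length] at hi
    rw [Walk.take_getVert, min_eq_right (by omega)] at hqt hqs
    have ht' := w₂.support_takeUntil_subset_support hr ht
    have hin : i < n := by
      by_contra! hni
      exact hmin i (by omega) ⟨hni, by omega, t, ht', hqt⟩
    have hip := Walk.dist_getVert_of_length_eq_dist h₁ hin.le hn
    have hij := Walk.dist_getVert_of_length_eq_dist h₁ (hin.le.trans hnj) hj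
    have him := Walk.dist_getVert_of_length_eq_dist h₁ (i := i) (j := j - 1) (by omega) (by omega)
    have hmj := Walk.dist_getVert_of_length_eq_dist h₁ (Nat.sub_le j 1) hj
    have hmjr := hG.dist_triangle (u := w₁.getVert (j - 1)) (v := w₁.getVert j) (w := r)
    have hbound : j - i ≤ 4 * K + 1 := by
      rcases eq_or_ne s r with rfl | hne
      · have := hG.dist_triangle (u := w₁.getVert i) (v := s) (w := w₁.getVert j)
        rw [G.dist_comm (u := s)] at this
        omega
      · have := hG.pos_dist_of_ne hne
        have := hG.dist_triangle (u := w₁.getVert i) (v := s) (w := w₁.getVert (j - 1))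
        rw [G.dist_comm (u := s) (v := w₁.getVert (j - 1))] at this
        omega
    rcases le_or_gt (j - n) (2 * K) with hle | hgt
    · exact ⟨r, hr, by omega⟩
    · refine ⟨t, ht', ?_⟩
      have := hG.dist_triangle (u := w₁.getVert n) (v := w₁.getVert i) (w := t)
      rw [G.dist_comm (u := w₁.getVert n) (v := w₁.getVert i)] at this
      omega

end SimpleGraph

/-- hexagon argument: In a connected simple graph `G` in which
every geodesic triangle is `k`-centered, if `g₁, g₂, g₃` are geodesics with
`gᵢ` from `aᵢ` to `bᵢ` and `d(b₁,a₂) ≤ D`, `d(b₂,a₃) ≤ D`, `d(b₃,a₁) ≤ D`,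
then there is a vertex `z` whose distance to each of the three geodesics is at
most `5k + D`. -/
theorem hexagon_center {V : Type*} (G : SimpleGraph V) (hG : G.Connected)
    (k D : ℝ) (hk : 0 ≤ k) (hD : 0 ≤ D)
    (hcent : ∀ (a b c : V) (w₁ : G.Walk a b) (w₂ : G.Walk b c) (w₃ : G.Walk c a),
      w₁.length = G.dist a b → w₂.length = G.dist b c → w₃.length = G.dist c a →
      ∃ z : V,
        (∃ p ∈ w₁.support, (G.dist z p : ℝ) ≤ k) ∧
        (∃ p ∈ w₂.support, (G.dist z p : ℝ) ≤ k) ∧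
        (∃ p ∈ w₃.support, (G.dist z p : ℝ) ≤ k)) :
    ∀ (a₁ b₁ a₂ b₂ a₃ b₃ : V)
      (g₁ : G.Walk a₁ b₁) (g₂ : G.Walk a₂ b₂) (g₃ : G.Walk a₃ b₃),
      g₁.length = G.dist a₁ b₁ → g₂.length = G.dist a₂ b₂ →
      g₃.length = G.dist a₃ b₃ →
      (G.dist b₁ a₂ : ℝ) ≤ D → (G.dist b₂ a₃ : ℝ) ≤ D →
      (G.dist b₃ a₁ : ℝ) ≤ D →
      ∃ z : V,
        (∃ p ∈ g₁.support, (G.dist z p : ℝ) ≤ 5 * k + D) ∧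
        (∃ p ∈ g₂.support, (G.dist z p : ℝ) ≤ 5 * k + D) ∧
        (∃ p ∈ g₃.support, (G.dist z p : ℝ) ≤ 5 * k + D) := by
  intro a₁ b₁ a₂ b₂ a₃ b₃ g₁ g₂ g₃ h₁ h₂ h₃ h₁₂ h₂₃ h₃₁
  have hK : G.HasCenteredTriangles ⌊k⌋₊ := by
    simpa only [SimpleGraph.HasCenteredTriangles, Nat.le_floor_iff hk] using hcent
  obtain ⟨w₁, hw₁⟩ := hG.exists_walk_length_eq_dist a₁ a₂
  obtain ⟨w₂, hw₂⟩ := hG.exists_walk_length_eq_dist a₂ a₃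
  obtain ⟨w₃, hw₃⟩ := hG.exists_walk_length_eq_dist a₃ a₁
  obtain ⟨z, hz₁, hz₂, hz₃⟩ := hcent a₁ a₂ a₃ w₁ w₂ w₃ hw₁ hw₂ hw₃
  have key : ∀ {x y y' : V} (w : G.Walk x y) (g : G.Walk x y'), w.length = G.dist x y →
      g.length = G.dist x y' → (G.dist y' y : ℝ) ≤ D →
      (∃ p ∈ w.support, (G.dist z p : ℝ) ≤ k) →
      ∃ p ∈ g.support, (G.dist z p : ℝ) ≤ 5 * k + D := by
    rintro x y y' w g hw hg hD' ⟨p, hp, hzp⟩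
    obtain ⟨r, hr, hpr⟩ := hK.exists_mem_support_dist_le hG hw hg hp
    refine ⟨r, hr, ?_⟩
    have hzr : (G.dist z r : ℝ) ≤ G.dist z p + G.dist p r := mod_cast hG.dist_triangle
    have hpr' : (G.dist p r : ℝ) ≤ 4 * ⌊k⌋₊ + G.dist y' y := by
      rw [G.dist_comm (u := y')]
      exact_mod_cast hpr
    linarith [Nat.floor_le hk]
  exact ⟨z, key w₁ g₁ hw₁ h₁ h₁₂ hz₁, key w₂ g₂ hw₂ h₂ h₂₃ hz₂, key w₃ g₃ hw₃ h₃ h₃₁ hz₃⟩
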